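/- Let A = ℂ[x^{±1}, y^{±1}] ⊗ Λ(ξ, η) be the ℤ/2-graded-commutative ℂ-algebra generated by invertible even elements x, y and odd elements ξ, η, and fix λ ∈ ℂ with λ arbitrary. Let u : A → A be the odd superderivation determined by u(x) = u(y) = η − λξ, u(ξ) = y − x, u(η) = λ(y − x), i.e., u = (η − λξ)(∂_x + ∂_y) + (y − x)(∂_ξ + λ∂_η). Then u ∘ u = 0, and the cohomology ker u / u(A) is a 2-dimensional ℂ-vector space spanned by the classes of 1 and x⁻¹(η − λξ). (This computes the Duflo–Serganova cohomology of the coordinate Hopf superalgebra ℂ[GL(1|1)] with respect to the adjoint vector field of the odd element u = E + λF of gl(1|1), and shows that the resulting supergroup GL(1|1)~_u is the odd additive supergroup 𝔾_a^{0|1}.) -/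

import Mathlib

open scoped TensorProduct

noncomputable section

/-- The coordinate superalgebra `A = ℂ[x^{±1}, y^{±1}] ⊗ Λ(ξ, η)` of `GL(1|1)`:
the Laurent polynomial ring in two variables tensored with the exterior algebra on
two generators.  Since the first factor is purely even, the ordinary tensor-product
algebra structure agrees with the supercommutative one. -/
abbrev GL11Coord : Type :=
  AddMonoidAlgebra ℂ (ℤ × ℤ) ⊗[ℂ] ExteriorAlgebra ℂ (Fin 2 → ℂ)

/-- The even generator `x`. -/
def glX : GL11Coord := AddMonoidAlgebra.single ((1 : ℤ), (0 : ℤ)) (1 : ℂ) ⊗ₜ[ℂ] 1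

/-- The even generator `y`. -/
def glY : GL11Coord := AddMonoidAlgebra.single ((0 : ℤ), (1 : ℤ)) (1 : ℂ) ⊗ₜ[ℂ] 1

/-- The inverse `x⁻¹` of the even generator `x`. -/
def glXinv : GL11Coord := AddMonoidAlgebra.single ((-1 : ℤ), (0 : ℤ)) (1 : ℂ) ⊗ₜ[ℂ] 1

/-- The odd generator `ξ`. -/
def glXi : GL11Coord := 1 ⊗ₜ[ℂ] ExteriorAlgebra.ι ℂ (Pi.single (0 : Fin 2) (1 : ℂ))

/-- The odd generator `η`. -/
def glEta : GL11Coord := 1 ⊗ₜ[ℂ] ExteriorAlgebra.ι ℂ (Pi.single (1 : Fin 2) (1 : ℂ))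

/-- The parity (grading) involution of `A`, acting by `+1` on even elements and `-1`
on odd elements: the identity on the Laurent factor tensored with the canonical
involution of the exterior algebra. -/
def glParity : GL11Coord →ₐ[ℂ] GL11Coord :=
  Algebra.TensorProduct.map (AlgHom.id ℂ (AddMonoidAlgebra ℂ (ℤ × ℤ)))
    CliffordAlgebra.involute

open ExteriorAlgebra in
/-- The family `1, ξ, ζ, ξζ` in the exterior algebra, where `ζ = η - λξ`. -/
def extFamily (lam : ℂ) : Fin 4 → ExteriorAlgebra ℂ (Fin 2 → ℂ) :=
  ![1, ι ℂ (Pi.single 0 1), ι ℂ (Pi.single 1 1 - lam • Pi.single 0 1),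
    ι ℂ (Pi.single 0 1) * ι ℂ (Pi.single 1 1 - lam • Pi.single 0 1)]

theorem linearIndependent_extFamily (lam : ℂ) : LinearIndependent ℂ (extFamily lam) := by
  rw [Fintype.linearIndependent_iff]
  intro g hg
  let ε : ExteriorAlgebra ℂ (Fin 2 → ℂ) →ₗ[ℂ] ℂ :=
    (ExteriorAlgebra.algebraMapInv (R := ℂ) (M := Fin 2 → ℂ)).toLinearMap
  let p : Module.Dual ℂ (Fin 2 → ℂ) := LinearMap.proj 0 + lam • LinearMap.proj 1
  let q : Module.Dual ℂ (Fin 2 → ℂ) := LinearMap.proj 1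
  let P := CliffordAlgebra.contractLeft (Q := (0 : QuadraticForm ℂ (Fin 2 → ℂ))) p
  let R := CliffordAlgebra.contractLeft (Q := (0 : QuadraticForm ℂ (Fin 2 → ℂ))) q
  have hε (v : Fin 2 → ℂ) : ε (CliffordAlgebra.ι 0 v) = 0 :=
    ExteriorAlgebra.lift_ι_apply _ _ _ _
  have hε1 : ε 1 = 1 := map_one ExteriorAlgebra.algebraMapInv
  have hεm (a b) : ε (a * b) = ε a * ε b := map_mul ExteriorAlgebra.algebraMapInv a b
  simp only [Fin.sum_univ_four, extFamily, ExteriorAlgebra.ι] at hg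
  have h0 := congrArg ε hg
  have h1 := congrArg (fun a => ε (P a)) hg
  have h2 := congrArg (fun a => ε (R a)) hg
  have h3 := congrArg (fun a => ε (R (P a))) hg
  simp [hε, hε1, hεm] at h0
  simp [hε, hε1, P, p, CliffordAlgebra.contractLeft_ι_mul,
    Algebra.algebraMap_eq_smul_one] at h1
  simp [hε, hε1, R, q, CliffordAlgebra.contractLeft_ι_mul,
    Algebra.algebraMap_eq_smul_one] at h2
  simp [hε1, P, R, p, q, CliffordAlgebra.contractLeft_ι_mul,
    Algebra.algebraMap_eq_smul_one] at h3
  intro i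
  fin_cases i <;> simp_all

theorem exists_extFamily_coords (lam : ℂ) (a : ExteriorAlgebra ℂ (Fin 2 → ℂ)) :
    ∃ c : Fin 4 → ℂ, ∑ i, c i • extFamily lam i = a := by
  simp only [Fin.sum_univ_four, extFamily]
  set X := ExteriorAlgebra.ι ℂ (Pi.single 0 1 : Fin 2 → ℂ) with hX
  set Z := ExteriorAlgebra.ι ℂ (Pi.single 1 1 - lam • Pi.single 0 1 : Fin 2 → ℂ) with hZ
  have hXX : X * X = 0 := ExteriorAlgebra.ι_sq_zero _
  have hZZ : Z * Z = 0 := ExteriorAlgebra.ι_sq_zero _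
  have hZX : Z * X = -(X * Z) :=
    eq_neg_of_add_eq_zero_left (ExteriorAlgebra.ι_add_mul_swap _ _)
  induction a using ExteriorAlgebra.induction with
  | algebraMap r => exact ⟨![r, 0, 0, 0], by simp [Algebra.algebraMap_eq_smul_one]⟩
  | ι v =>
    refine ⟨![0, v 0 + lam * v 1, v 1, 0], ?_⟩
    have hv : v = (v 0 + lam * v 1) • (Pi.single 0 1 : Fin 2 → ℂ)
        + v 1 • (Pi.single 1 1 - lam • Pi.single 0 1) := by
      ext i; fin_cases i <;> simp; ring
    conv_rhs => rw [hv]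
    simp [hX, hZ]
  | add a b ha hb =>
    obtain ⟨c, rfl⟩ := ha
    obtain ⟨d, rfl⟩ := hb
    refine ⟨c + d, ?_⟩
    simp only [Pi.add_apply]
    module
  | mul a b ha hb =>
    obtain ⟨c, rfl⟩ := ha
    obtain ⟨d, rfl⟩ := hb
    refine ⟨![c 0 * d 0, c 0 * d 1 + c 1 * d 0, c 0 * d 2 + c 2 * d 0,
      c 0 * d 3 + c 3 * d 0 + c 1 * d 2 - c 2 * d 1], ?_⟩
    have h1 : X * (X * Z) = 0 := by rw [← mul_assoc, hXX, zero_mul]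
    have h2 : Z * (X * Z) = 0 := by rw [← mul_assoc, hZX, neg_mul, mul_assoc, hZZ, mul_zero,
      neg_zero]
    have h3 : X * Z * X = 0 := by rw [mul_assoc, hZX, mul_neg, h1, neg_zero]
    have h4 : X * Z * Z = 0 := by rw [mul_assoc, hZZ, mul_zero]
    have h5 : X * Z * (X * Z) = 0 := by rw [mul_assoc, h2, mul_zero]
    simp only [Matrix.cons_val_zero, Matrix.cons_val_one, Matrix.cons_val, mul_add, add_mul,
      smul_mul_assoc, mul_smul_comm, one_mul, mul_one, hXX, hZZ, hZX, h1, h2, h3, h4, h5]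
    module

/-- The basis `1, ξ, ζ, ξζ` of `A` over the Laurent polynomials, where `ζ = η - λξ`. -/
def glBasis (lam : ℂ) : Module.Basis (Fin 4) (AddMonoidAlgebra ℂ (ℤ × ℤ)) GL11Coord :=
  Algebra.TensorProduct.basis _ (Module.Basis.mk (linearIndependent_extFamily lam) fun a _ => by
    obtain ⟨c, rfl⟩ := exists_extFamily_coords lam a
    exact Submodule.sum_mem _ fun i _ => Submodule.smul_mem _ _ (Submodule.subset_span ⟨i, rfl⟩))

theorem glBasis_apply (lam : ℂ) (i : Fin 4) : glBasis lam i = 1 ⊗ₜ extFamily lam i := by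
  simp [glBasis]

/-- The odd element `ζ = η - λξ`. -/
def glZeta (lam : ℂ) : GL11Coord := glEta - lam • glXi

theorem glZeta_eq_tmul (lam : ℂ) :
    glZeta lam = 1 ⊗ₜ ExteriorAlgebra.ι ℂ (Pi.single 1 1 - lam • Pi.single 0 1) := by
  simp [glZeta, glEta, glXi, TensorProduct.tmul_sub]

/-- The general element `f + gξ + hζ + kξζ` of `A`. -/
def glElem (lam : ℂ) (f g h k : AddMonoidAlgebra ℂ (ℤ × ℤ)) : GL11Coord :=
  f • 1 + g • glXi + h • glZeta lam + k • (glXi * glZeta lam)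

theorem glElem_eq_sum (lam : ℂ) (f : Fin 4 → AddMonoidAlgebra ℂ (ℤ × ℤ)) :
    glElem lam (f 0) (f 1) (f 2) (f 3) = ∑ i, f i • glBasis lam i := by
  have hz : glZeta lam = 1 ⊗ₜ extFamily lam 2 := glZeta_eq_tmul lam
  have hxz : glXi * glZeta lam = 1 ⊗ₜ extFamily lam 3 := by
    rw [hz]; simp [glXi, extFamily]
  have h1 : (1 : GL11Coord) = 1 ⊗ₜ extFamily lam 0 := rfl
  have hx : glXi = 1 ⊗ₜ extFamily lam 1 := rfl
  rw [Fin.sum_univ_four, glElem, hxz, hz, h1, hx]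
  simp only [glBasis_apply]

theorem exists_eq_glElem (lam : ℂ) (a : GL11Coord) : ∃ f g h k, a = glElem lam f g h k :=
  ⟨_, _, _, _, by rw [glElem_eq_sum lam ((glBasis lam).equivFun a), Module.Basis.sum_equivFun]⟩

theorem glElem_inj {lam : ℂ} {f g h k f' g' h' k' : AddMonoidAlgebra ℂ (ℤ × ℤ)}
    (H : glElem lam f g h k = glElem lam f' g' h' k') : f = f' ∧ g = g' ∧ h = h' ∧ k = k' := by
  have e₁ := glElem_eq_sum lam ![f, g, h, k]
  have e₂ := glElem_eq_sum lam ![f', g', h', k']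
  have e : ![f, g, h, k] = ![f', g', h', k'] := by
    apply (glBasis lam).equivFun.symm.injective
    simp only [Module.Basis.equivFun_symm_apply]
    simp_all
  exact ⟨congrFun e 0, congrFun e 1, congrFun e 2, congrFun e 3⟩

namespace AddMonoidAlgebra

/-- The derivation `∂_x + ∂_y` of `ℂ[x^{±1}, y^{±1}]`. -/
def diagDeriv : AddMonoidAlgebra ℂ (ℤ × ℤ) →ₗ[ℂ] AddMonoidAlgebra ℂ (ℤ × ℤ) :=
  Finsupp.lsum ℂ (fun p : ℤ × ℤ =>
    (p.1 : ℂ) • lsingle (p - (1, 0)) + (p.2 : ℂ) • lsingle (p - (0, 1)))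
    ∘ₗ (coeffLinearEquiv ℂ).toLinearMap

/-- The derivation `d/dx` of `ℂ[x^{±1}]`. -/
def laurentDeriv : AddMonoidAlgebra ℂ ℤ →ₗ[ℂ] AddMonoidAlgebra ℂ ℤ :=
  Finsupp.lsum ℂ (fun n : ℤ => (n : ℂ) • lsingle (n - 1)) ∘ₗ (coeffLinearEquiv ℂ).toLinearMap

theorem diagDeriv_single (m n : ℤ) (c : ℂ) :
    diagDeriv (single (m, n) c) = single (m - 1, n) (m * c) + single (m, n - 1) (n * c) := by
  simp [diagDeriv, coeffLinearEquiv]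

theorem laurentDeriv_single (n : ℤ) (c : ℂ) :
    laurentDeriv (single n c) = single (n - 1) (n * c) := by
  simp [laurentDeriv, coeffLinearEquiv, -LaurentPolynomial.single_eq_C_mul_T]

/-- The equation `y - x` of the diagonal. -/
def diagEqn : AddMonoidAlgebra ℂ (ℤ × ℤ) := single (0, 1) 1 - single (1, 0) 1

/-- Restriction to the diagonal, `f(x, y) ↦ f(x, x)`. -/
def diagRestrict : AddMonoidAlgebra ℂ (ℤ × ℤ) →ₐ[ℂ] AddMonoidAlgebra ℂ ℤ :=
  mapDomainAlgHom ℂ ℂ (AddMonoidHom.fst ℤ ℤ + AddMonoidHom.snd ℤ ℤ)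

/-- The inclusion `ℂ[x^{±1}] → ℂ[x^{±1}, y^{±1}]`. -/
def laurentIncl : AddMonoidAlgebra ℂ ℤ →ₐ[ℂ] AddMonoidAlgebra ℂ (ℤ × ℤ) :=
  mapDomainAlgHom ℂ ℂ (AddMonoidHom.inl ℤ ℤ)

theorem diagRestrict_single (m n : ℤ) (c : ℂ) :
    diagRestrict (single (m, n) c) = single (m + n) c := by
  simp [diagRestrict]

theorem laurentIncl_single (n : ℤ) (c : ℂ) : laurentIncl (single n c) = single (n, 0) c := by
  simp [laurentIncl, -LaurentPolynomial.single_eq_C_mul_T]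

theorem diagEqn_ne_zero : diagEqn ≠ 0 := by
  intro h
  have := congrArg (fun a => a.coeff (0, 1)) h
  simp [diagEqn] at this

theorem diagRestrict_diagEqn : diagRestrict diagEqn = 0 := by
  simp [diagEqn, diagRestrict_single]

theorem diagDeriv_mul (f g : AddMonoidAlgebra ℂ (ℤ × ℤ)) :
    diagDeriv (f * g) = g * diagDeriv f + f * diagDeriv g := by
  induction f using AddMonoidAlgebra.induction_linear with
  | zero => simp
  | add f f' hf hf' => simp only [add_mul, mul_add, map_add, hf, hf']; abel
  | single p c =>
    induction g using AddMonoidAlgebra.induction_linear with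
    | zero => simp
    | add g g' hg hg' => simp only [add_mul, mul_add, map_add, hg, hg']; abel
    | single q d =>
      obtain ⟨m, n⟩ := p
      obtain ⟨m', n'⟩ := q
      simp only [single_mul_single, Prod.mk_add_mk, diagDeriv_single, mul_add, Int.cast_add,
        add_mul, single_add]
      rw [add_add_add_comm]
      congr 3 <;> ring_nf

theorem diagDeriv_mul_diagEqn (f : AddMonoidAlgebra ℂ (ℤ × ℤ)) :
    diagDeriv (f * diagEqn) = diagDeriv f * diagEqn := by
  have h : diagDeriv diagEqn = 0 := by
    simp only [diagEqn, map_sub, diagDeriv_single]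
    simp
  rw [diagDeriv_mul, h, mul_zero, add_zero, mul_comm]

theorem diagRestrict_diagDeriv (f : AddMonoidAlgebra ℂ (ℤ × ℤ)) :
    diagRestrict (diagDeriv f) = laurentDeriv (diagRestrict f) := by
  induction f using AddMonoidAlgebra.induction_linear with
  | zero => simp
  | add f g hf hg => simp only [map_add, hf, hg]
  | single p c =>
    obtain ⟨m, n⟩ := p
    simp only [diagDeriv_single, map_add, diagRestrict_single, laurentDeriv_single, Int.cast_add,
      add_mul, single_add]
    congr 2 <;> ring

theorem diagDeriv_laurentIncl (f : AddMonoidAlgebra ℂ ℤ) :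
    diagDeriv (laurentIncl f) = laurentIncl (laurentDeriv f) := by
  induction f using AddMonoidAlgebra.induction_linear with
  | zero => simp
  | add f g hf hg => simp only [map_add, hf, hg]
  | single n c =>
    simp only [diagDeriv_single, laurentIncl_single, laurentDeriv_single, Int.cast_zero, zero_mul,
      single_zero, add_zero]

theorem exists_eq_laurentIncl_add (f : AddMonoidAlgebra ℂ (ℤ × ℤ)) :
    ∃ g, f = laurentIncl (diagRestrict f) + g * diagEqn := by
  induction f using AddMonoidAlgebra.induction_linear with
  | zero => exact ⟨0, by simp⟩
  | add f g hf hg =>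
    obtain ⟨a, ha⟩ := hf
    obtain ⟨b, hb⟩ := hg
    refine ⟨a + b, ?_⟩
    nth_rw 1 [ha, hb]
    rw [map_add, map_add]
    ring
  | single p c =>
    obtain ⟨m, n⟩ := p
    simp only [diagRestrict_single, laurentIncl_single]
    induction n using Int.induction_on generalizing m with
    | zero => exact ⟨0, by simp⟩
    | succ n ih =>
      obtain ⟨g, hg⟩ := ih (m + 1)
      refine ⟨g + single (m, (n : ℤ)) c, ?_⟩
      rw [add_mul, ← add_assoc, show m + ((n : ℤ) + 1) = m + 1 + n by ring, ← hg, diagEqn]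
      simp [mul_sub, single_mul_single]
    | pred n ih =>
      obtain ⟨g, hg⟩ := ih (m - 1)
      refine ⟨g - single (m - 1, -(n : ℤ) - 1) c, ?_⟩
      rw [sub_mul, add_sub, show m + (-(n : ℤ) - 1) = m - 1 + -n by ring, ← hg, diagEqn]
      simp [mul_sub, single_mul_single]

theorem coeff_laurentDeriv (f : AddMonoidAlgebra ℂ ℤ) (n : ℤ) :
    (laurentDeriv f).coeff n = (n + 1) * f.coeff (n + 1) := by
  induction f using AddMonoidAlgebra.induction_linear with
  | zero => simp
  | add f g hf hg => simp [hf, hg, mul_add]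
  | single m c =>
    rw [laurentDeriv_single, coeff_single, coeff_single, Finsupp.single_apply,
      Finsupp.single_apply]
    by_cases h : m = n + 1
    · subst h; simp
    · rw [if_neg h, if_neg (by omega), mul_zero]

theorem eq_single_zero_of_laurentDeriv_eq_zero {f : AddMonoidAlgebra ℂ ℤ}
    (hf : laurentDeriv f = 0) : f = single 0 (f.coeff 0) := by
  ext n
  rw [coeff_single, Finsupp.single_apply]
  split_ifs with h
  · rw [h]
  · have := coeff_laurentDeriv f (n - 1)
    rw [hf] at this
    simpa [Ne.symm h] using this.symm

theorem exists_eq_single_add_laurentDeriv (f : AddMonoidAlgebra ℂ ℤ) :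
    ∃ (d : ℂ) (g : AddMonoidAlgebra ℂ ℤ), f = single (-1) d + laurentDeriv g := by
  induction f using AddMonoidAlgebra.induction_linear with
  | zero => exact ⟨0, 0, by simp⟩
  | add f g hf hg =>
    obtain ⟨a, f', rfl⟩ := hf
    obtain ⟨b, g', rfl⟩ := hg
    exact ⟨a + b, f' + g', by rw [single_add, map_add]; abel⟩
  | single n c =>
    by_cases h : n = -1
    · exact ⟨c, 0, by simp [h]⟩
    · refine ⟨0, single (n + 1) (c / (n + 1)), ?_⟩
      have : (n : ℂ) + 1 ≠ 0 := by exact_mod_cast fun h' : n + 1 = 0 => h (by omega)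
      rw [laurentDeriv_single, single_zero, zero_add, add_sub_cancel_right]
      push_cast
      rw [mul_div_cancel₀ _ this]

end AddMonoidAlgebra

open AddMonoidAlgebra

theorem glX_eq : glX = (single (1, 0) 1 : AddMonoidAlgebra ℂ (ℤ × ℤ)) • (1 : GL11Coord) := by
  rw [glX, Algebra.TensorProduct.one_def, TensorProduct.smul_tmul']; simp

theorem glY_eq : glY = (single (0, 1) 1 : AddMonoidAlgebra ℂ (ℤ × ℤ)) • (1 : GL11Coord) := by
  rw [glY, Algebra.TensorProduct.one_def, TensorProduct.smul_tmul']; simp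

theorem glXinv_eq :
    glXinv = (single (-1, 0) 1 : AddMonoidAlgebra ℂ (ℤ × ℤ)) • (1 : GL11Coord) := by
  rw [glXinv, Algebra.TensorProduct.one_def, TensorProduct.smul_tmul']; simp

theorem glY_sub_glX : glY - glX = diagEqn • (1 : GL11Coord) := by
  rw [glX_eq, glY_eq, diagEqn]
  module

theorem glParity_smul_one (f : AddMonoidAlgebra ℂ (ℤ × ℤ)) :
    glParity (f • (1 : GL11Coord)) = f • (1 : GL11Coord) := by
  rw [Algebra.TensorProduct.one_def, TensorProduct.smul_tmul']; simp [glParity]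

theorem glZeta_mul_self (lam : ℂ) : glZeta lam * glZeta lam = 0 := by
  rw [glZeta_eq_tmul, Algebra.TensorProduct.tmul_mul_tmul, ExteriorAlgebra.ι_sq_zero,
    TensorProduct.tmul_zero]

theorem glZeta_mul_glXi (lam : ℂ) : glZeta lam * glXi = (-1 : ℂ) • (glXi * glZeta lam) := by
  rw [glZeta_eq_tmul, glXi, Algebra.TensorProduct.tmul_mul_tmul,
    Algebra.TensorProduct.tmul_mul_tmul,
    ← TensorProduct.tmul_smul, neg_one_smul,
    eq_neg_of_add_eq_zero_left (ExteriorAlgebra.ι_add_mul_swap _ _)]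

theorem leibniz_smul {u : GL11Coord →ₗ[ℂ] GL11Coord}
    (hLeibniz : ∀ a b : GL11Coord, u (a * b) = u a * b + glParity a * u b)
    (f : AddMonoidAlgebra ℂ (ℤ × ℤ)) (a : GL11Coord) :
    u (f • a) = u (f • 1) * a + f • u a := by
  have := hLeibniz (f • 1) a
  rwa [glParity_smul_one, smul_one_mul, smul_one_mul] at this

/-- If `x` and `y` have the same image `z` under `u`, and `u` is a derivation on the Laurent
polynomials, then `u` is `(∂_x + ∂_y) · z` there. -/
theorem map_smul_one_eq_diagDeriv {u : GL11Coord →ₗ[ℂ] GL11Coord} {z : GL11Coord}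
    (hLeibniz : ∀ a b : GL11Coord, u (a * b) = u a * b + glParity a * u b)
    (hx : u glX = z) (hy : u glY = z) (f : AddMonoidAlgebra ℂ (ℤ × ℤ)) :
    u (f • 1) = diagDeriv f • z := by
  let δ : AddMonoidAlgebra ℂ (ℤ × ℤ) → GL11Coord := fun f => u (f • 1) - diagDeriv f • z
  have δ_mul (f g : AddMonoidAlgebra ℂ (ℤ × ℤ)) : δ (f * g) = g • δ f + f • δ g := by
    have h := leibniz_smul hLeibniz f (g • 1)
    rw [smul_smul, mul_smul_comm, mul_one] at h
    simp only [δ, h, diagDeriv_mul]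
    module
  have δ_single_add (p q : ℤ × ℤ) (hp : δ (single p 1) = 0) :
      δ (single (p + q) 1) = 0 ↔ δ (single q 1) = 0 := by
    have h : δ (single (p + q) 1) = (single p 1 : AddMonoidAlgebra ℂ (ℤ × ℤ)) • δ (single q 1) := by
      rw [← mul_one (1 : ℂ), ← single_mul_single, δ_mul, hp, smul_zero, zero_add, mul_one]
    refine ⟨fun h' => ?_, fun h' => by rw [h, h', smul_zero]⟩
    rw [← one_smul (AddMonoidAlgebra ℂ (ℤ × ℤ)) (δ (single q 1)), AddMonoidAlgebra.one_def,
      ← neg_add_cancel p, ← mul_one (1 : ℂ), ← single_mul_single, mul_smul, mul_one, ← h, h',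
      smul_zero]
  have δ_x : δ (single (1, 0) 1) = 0 := by
    simp only [δ, ← glX_eq, hx, diagDeriv_single]
    simp [← Prod.zero_eq_mk, ← AddMonoidAlgebra.one_def]
  have δ_y : δ (single (0, 1) 1) = 0 := by
    simp only [δ, ← glY_eq, hy, diagDeriv_single]
    simp [← Prod.zero_eq_mk, ← AddMonoidAlgebra.one_def]
  have δ_single (m n : ℤ) : δ (single (m, n) 1) = 0 := by
    induction m using Int.induction_on with
    | zero =>
      induction n using Int.induction_on with
      | zero => exact (δ_single_add (0, 1) (0, 0) δ_y).1 δ_y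
      | succ n ih => simpa [add_comm] using (δ_single_add (0, 1) (0, n) δ_y).2 ih
      | pred n ih => exact (δ_single_add (0, 1) (0, -n - 1) δ_y).1 (by simpa using ih)
    | succ m ih => simpa [add_comm] using (δ_single_add (1, 0) (m, n) δ_x).2 ih
    | pred m ih => exact (δ_single_add (1, 0) (-m - 1, n) δ_x).1 (by simpa using ih)
  induction f using AddMonoidAlgebra.induction_linear with
  | zero => simp
  | add f g hf hg => simp only [map_add, add_smul, hf, hg]
  | single p c =>
    have e : (single p c : AddMonoidAlgebra ℂ (ℤ × ℤ)) = c • single (p.1, p.2) 1 := by simp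
    rw [e, smul_assoc, u.map_smul, diagDeriv.map_smul, smul_assoc, sub_eq_zero.1 (δ_single p.1 p.2)]

/-- The superderivation `u` in the coordinates `1, ξ, ζ, ξζ`. -/
theorem map_glElem {lam : ℂ} {u : GL11Coord →ₗ[ℂ] GL11Coord}
    (hLeibniz : ∀ a b : GL11Coord, u (a * b) = u a * b + glParity a * u b)
    (hx : u glX = glZeta lam) (hy : u glY = glZeta lam) (hxi : u glXi = glY - glX)
    (heta : u glEta = lam • (glY - glX)) (f g h k : AddMonoidAlgebra ℂ (ℤ × ℤ)) :
    u (glElem lam f g h k)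
      = glElem lam (g * diagEqn) 0 (diagDeriv f + k * diagEqn) (-diagDeriv g) := by
  have hD := map_smul_one_eq_diagDeriv hLeibniz hx hy
  have hz : u (glZeta lam) = 0 := by rw [glZeta, map_sub, map_smul, heta, hxi, sub_self]
  have hxz : u (glXi * glZeta lam) = diagEqn • glZeta lam := by
    rw [hLeibniz, hz, mul_zero, add_zero, hxi, glY_sub_glX, smul_one_mul]
  have hzz : (-1 : ℂ) • (glXi * glZeta lam) * glZeta lam = 0 := by
    rw [smul_mul_assoc, mul_assoc, glZeta_mul_self, mul_zero, smul_zero]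
  rw [glElem, map_add, map_add, map_add, hD, leibniz_smul hLeibniz g, leibniz_smul hLeibniz h,
    leibniz_smul hLeibniz k, hD, hD, hD, hz, hxz, hxi, glY_sub_glX, smul_mul_assoc, smul_mul_assoc,
    smul_mul_assoc, glZeta_mul_self, ← mul_assoc, glZeta_mul_glXi,
    hzz, glElem]
  simp only [smul_zero]
  module

/-- The candidate representatives in the coordinates `1, ξ, ζ, ξζ`. -/
theorem representative_eq_glElem (lam c d : ℂ) :
    c • (1 : GL11Coord) + d • (glXinv * glZeta lam)
      = glElem lam (single 0 c) 0 (single (-1, 0) d) 0 := by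
  have hc : (single 0 c : AddMonoidAlgebra ℂ (ℤ × ℤ)) = c • 1 := by
    rw [AddMonoidAlgebra.one_def]; simp
  have hd : (single (-1, 0) d : AddMonoidAlgebra ℂ (ℤ × ℤ)) = d • single (-1, 0) 1 := by simp
  rw [glElem, glXinv_eq, smul_one_mul, hc, hd, smul_assoc, smul_assoc, one_smul]
  simp

/-- Duflo–Serganova cohomology of `ℂ[GL(1|1)]` for the adjoint vector field of the
odd element `u = E + λF` of `gl(1|1)`: the odd superderivation `u` with
`u x = u y = η − λξ`, `u ξ = y − x`, `u η = λ(y − x)` squares to zero, and its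
cohomology `ker u / u(A)` is two-dimensional, spanned by the classes of `1` and
`x⁻¹(η − λξ)`. -/
theorem gl11_ds_cohomology (lam : ℂ) (u : GL11Coord →ₗ[ℂ] GL11Coord)
    (hLeibniz : ∀ a b : GL11Coord, u (a * b) = u a * b + glParity a * u b)
    (hx : u glX = glEta - lam • glXi)
    (hy : u glY = glEta - lam • glXi)
    (hxi : u glXi = glY - glX)
    (heta : u glEta = lam • (glY - glX)) :
    (∀ a : GL11Coord, u (u a) = 0) ∧
    (∀ a ∈ LinearMap.ker u, ∃ c d : ℂ,
        a - (c • (1 : GL11Coord) + d • (glXinv * (glEta - lam • glXi)))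
          ∈ LinearMap.range u) ∧
    (∀ c d : ℂ,
        c • (1 : GL11Coord) + d • (glXinv * (glEta - lam • glXi))
          ∈ LinearMap.range u → c = 0 ∧ d = 0) := by
  have hu := map_glElem hLeibniz hx hy hxi heta
  simp only [show glEta - lam • glXi = glZeta lam from rfl, representative_eq_glElem]
  refine ⟨fun a => ?_, fun a ha => ?_, fun c d ⟨b, hb⟩ => ?_⟩
  · obtain ⟨f, g, h, k, rfl⟩ := exists_eq_glElem lam a
    rw [hu, hu, diagDeriv_mul_diagEqn]
    simp [glElem]
  · obtain ⟨f, g, h, k, rfl⟩ := exists_eq_glElem lam a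
    have h0 : (0 : GL11Coord) = glElem lam 0 0 0 0 := by simp [glElem]
    rw [LinearMap.mem_ker, hu, h0] at ha
    obtain ⟨hg, -, hf, -⟩ := glElem_inj ha
    obtain rfl := (mul_eq_zero.1 hg).resolve_right diagEqn_ne_zero
    have hr : laurentDeriv (diagRestrict f) = 0 := by
      rw [← diagRestrict_diagDeriv, eq_neg_of_add_eq_zero_left hf, map_neg, map_mul,
        diagRestrict_diagEqn, mul_zero, neg_zero]
    obtain ⟨f', hf'⟩ := exists_eq_laurentIncl_add f
    rw [eq_single_zero_of_laurentDeriv_eq_zero hr, laurentIncl_single] at hf'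
    generalize (diagRestrict f).coeff 0 = c at hf'
    obtain ⟨h', hh'⟩ := exists_eq_laurentIncl_add h
    obtain ⟨d, F, hF⟩ := exists_eq_single_add_laurentDeriv (diagRestrict h)
    rw [hF, map_add, laurentIncl_single, ← diagDeriv_laurentIncl] at hh'
    have hk : k = -diagDeriv f' := by
      rw [hf', map_add, diagDeriv_single, diagDeriv_mul_diagEqn] at hf
      simp only [Int.cast_zero, zero_mul, single_zero, zero_add, ← add_mul] at hf
      exact eq_neg_of_add_eq_zero_right ((mul_eq_zero.1 hf).resolve_right diagEqn_ne_zero)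
    refine ⟨c, d, glElem lam (laurentIncl F) f' 0 h', ?_⟩
    rw [hu, hk, hf', hh', Prod.mk_zero_zero]
    simp only [glElem]
    module
  · obtain ⟨f, g, h, k, rfl⟩ := exists_eq_glElem lam b
    rw [hu] at hb
    obtain ⟨h0, -, h2, -⟩ := glElem_inj hb
    have h0 := congrArg (fun a => (diagRestrict a).coeff 0) h0
    have h2 := congrArg (fun a => (diagRestrict a).coeff (-1)) h2
    simp only [← Prod.mk_zero_zero, map_add, map_mul, diagRestrict_diagEqn, diagRestrict_diagDeriv,
      diagRestrict_single, mul_zero, add_zero, coeff_laurentDeriv] at h0 h2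
    constructor
    · simpa using h0.symm
    · simpa [-LaurentPolynomial.single_eq_C_mul_T] using h2.symm

end
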